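/- Let c be a Deflate coding on the alphabet Fin n whose Kraft sum ∑_{i : Fin n, c i ≠ []} (1/2)^(length (c i)) is strictly less than 1. Then no code of c is a nonempty all-ones string: for every k : Fin n and every m > 0, c k ≠ List.replicate m true. -/

import Mathlib

/-- Lexicographic order on bit strings (false = 0, true = 1). -/
inductive BitLex : List Bool → List Bool → Prop
  | nil (b : List Bool) : BitLex [] b
  | false_true (a b : List Bool) : BitLex (false :: a) (true :: b)
  | cons (j : Bool) (a b : List Bool) : BitLex a b → BitLex (j :: a) (j :: b)

/-- A Deflate coding on the alphabet `Fin n`. -/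
def DeflateCoding {n : ℕ} (c : Fin n → List Bool) : Prop :=
  (∀ a b : Fin n, a ≠ b → c a ≠ [] → ¬ (c a <+: c b)) ∧
  (∀ a b : Fin n, (c a).length < (c b).length → BitLex (c a) (c b)) ∧
  (∀ a b : Fin n, (c a).length = (c b).length → a ≤ b → BitLex (c a) (c b)) ∧
  (∀ (a : Fin n) (l : List Bool), l ≠ [] → BitLex l (c a) → l.length = (c a).length →
    ∃ b : Fin n, c b ≠ [] ∧ c b <+: l)

/-- The Kraft sum of a coding, computed in ℚ. -/
def kraftSum {n : ℕ} (c : Fin n → List Bool) : ℚ :=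
  ∑ i ∈ Finset.univ.filter (fun i : Fin n => c i ≠ []), (1 / 2 : ℚ) ^ (c i).length

theorem bitLex_ones (l : List Bool) : BitLex l (List.replicate l.length true) := by
  induction l with
  | nil => exact BitLex.nil _
  | cons j l ih =>
    rw [List.length_cons, List.replicate_succ]
    cases j
    · exact BitLex.false_true _ _
    · exact BitLex.cons _ _ _ ih

theorem kraft_cover {ι : Type} (m : ℕ) : ∀ (S : Finset ι) (f : ι → List Bool),
    (∀ l : List Bool, l.length = m → ∃ i ∈ S, f i <+: l) →
    (1 : ℚ) ≤ ∑ i ∈ S, (1 / 2 : ℚ) ^ (f i).length := by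
  have base : ∀ (S : Finset ι) (f : ι → List Bool), (∃ i ∈ S, f i = []) →
      (1 : ℚ) ≤ ∑ i ∈ S, (1 / 2 : ℚ) ^ (f i).length := by
    rintro S f ⟨i, hi, hfi⟩
    have h := Finset.single_le_sum (f := fun i => (1 / 2 : ℚ) ^ (f i).length)
      (fun i _ => by positivity) hi
    simpa [hfi] using h
  induction m with
  | zero =>
    intro S f h
    obtain ⟨i, hi, hp⟩ := h [] rfl
    exact base S f ⟨i, hi, List.prefix_nil.mp hp⟩
  | succ m ih =>
    intro S f h
    by_cases hn : ∃ i ∈ S, f i = []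
    · exact base S f hn
    have key : ∀ j : Bool, (1 / 2 : ℚ) ≤
        ∑ i ∈ S.filter (fun i => (f i).head? = some j), (1 / 2 : ℚ) ^ (f i).length := by
      intro j
      have h1 := ih (S.filter (fun i => (f i).head? = some j)) (fun i => (f i).tail) (by
        intro l hl
        obtain ⟨i, hi, hp⟩ := h (j :: l) (by simp [hl])
        refine ⟨i, ?_⟩
        cases hfi : f i with
        | nil => exact absurd ⟨i, hi, hfi⟩ hn
        | cons a t =>
          rw [hfi, List.cons_prefix_cons] at hp
          simp [hi, hfi, hp.1, hp.2])
      have h2 : ∑ i ∈ S.filter (fun i => (f i).head? = some j), (1 / 2 : ℚ) ^ (f i).length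
          = (1 / 2) * ∑ i ∈ S.filter (fun i => (f i).head? = some j),
            (1 / 2 : ℚ) ^ (f i).tail.length := by
        rw [Finset.mul_sum]
        refine Finset.sum_congr rfl fun i hi => ?_
        have hh := (Finset.mem_filter.mp hi).2
        cases hfi : f i with
        | nil => simp [hfi] at hh
        | cons a t => simp only [List.length_cons, List.tail_cons]; ring
      rw [h2]
      linarith
    have hs := Finset.sum_filter_add_sum_filter_not S (fun i => (f i).head? = some true)
      (fun i => (1 / 2 : ℚ) ^ (f i).length)
    have he : S.filter (fun i => ¬ (f i).head? = some true)
        = S.filter (fun i => (f i).head? = some false) := by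
      refine Finset.filter_congr fun i hi => ?_
      cases hfi : f i with
      | nil => exact absurd ⟨i, hi, hfi⟩ hn
      | cons a t => simp
    rw [he] at hs
    have := key true
    have := key false
    linarith

theorem no_all_ones_of_kraft_lt_one {n : ℕ} (c : Fin n → List Bool)
    (hc : DeflateCoding c) (hlt : kraftSum c < 1) :
    ∀ (k : Fin n) (m : ℕ), 0 < m → c k ≠ List.replicate m true := by
  intro k m hm hk
  obtain ⟨-, -, -, h4⟩ := hc
  refine absurd hlt (not_lt.mpr (kraft_cover m _ c ?_))
  intro l hl
  obtain ⟨b, hb, hp⟩ := h4 k l (by rintro rfl; simp at hl; omega)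
    (by rw [hk, ← hl]; exact bitLex_ones l) (by simp [hk, hl])
  exact ⟨b, by simp [hb], hp⟩
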